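/- Let r > 1 be a real number that is not an integer, and set q = ⌊r⌋ + 1, Q = 2^q, κ = 1/(4Q − 2), λ = 1 − (q + 1)/(4Q − 2). There exist constants C = C(r) and x_0 = x_0(r) such that for all x ≥ x_0, all integers e ≥ 1 and all integers ℓ with 0 ≤ ℓ ≤ e − 1, the number of positive integers k ≤ (log(2x)/log 2)^{1/r} with ⌊k^r⌋ ≡ ℓ (mod e) is at most C·( (log x)^{1/r}/e + (log x)^{(1/r)·(rκ + λ)/(1 + κ)} · e^{−κ/(1+κ)} + e^{1/r} ). -/

import Mathlib

/-- The additive character `x ↦ exp (2 π i x)` of the real line. -/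
noncomputable def unitPhase (x : ℝ) : ℂ :=
  Complex.exp (Complex.I * ((2 * Real.pi * x : ℝ) : ℂ))

lemma unitPhase_add (x y : ℝ) : unitPhase (x + y) = unitPhase x * unitPhase y := by
  simp only [unitPhase, ← Complex.exp_add]
  congr 1
  push_cast
  ring

lemma norm_unitPhase (x : ℝ) : ‖unitPhase x‖ = 1 := by
  rw [unitPhase, mul_comm]
  exact Complex.norm_exp_ofReal_mul_I _

lemma conj_unitPhase (x : ℝ) : (starRingEnd ℂ) (unitPhase x) = unitPhase (-x) := by
  simp only [unitPhase, ← Complex.exp_conj, map_mul, Complex.conj_I, Complex.conj_ofReal]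
  congr 1
  push_cast
  ring

lemma unitPhase_mul_conj (x y : ℝ) :
    unitPhase x * (starRingEnd ℂ) (unitPhase y) = unitPhase (x - y) := by
  rw [conj_unitPhase, ← unitPhase_add, sub_eq_add_neg]

lemma unitPhase_intCast (n : ℤ) : unitPhase n = 1 := by
  rw [unitPhase, Complex.exp_eq_one_iff]
  exact ⟨n, by push_cast; ring⟩

lemma norm_unitPhase_sub_le (x y : ℝ) :
    ‖unitPhase x - unitPhase y‖ ≤ 2 * Real.pi * |x - y| := by
  have h : unitPhase x - unitPhase y = unitPhase y * (unitPhase (x - y) - 1) := by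
    rw [mul_sub, ← unitPhase_add]
    simp
  rw [h, norm_mul, norm_unitPhase, one_mul]
  refine Real.norm_exp_I_mul_ofReal_sub_one_le.trans_eq ?_
  rw [Real.norm_eq_abs, abs_mul, abs_of_pos Real.two_pi_pos]

lemma four_mul_abs_le_norm_unitPhase_sub_one {x : ℝ} (hx : |x| ≤ 1 / 2) :
    4 * |x| ≤ ‖unitPhase x - 1‖ := by
  have hpi := Real.pi_pos
  have habs : |Real.pi * x| = Real.pi * |x| := by rw [abs_mul, abs_of_pos hpi]
  have h := Real.mul_abs_le_abs_sin (x := Real.pi * x) (by rw [habs]; nlinarith)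
  rw [unitPhase, Complex.norm_exp_I_mul_ofReal_sub_one, Real.norm_eq_abs, abs_mul,
    abs_of_pos (two_pos : (0 : ℝ) < 2), show 2 * Real.pi * x / 2 = Real.pi * x by ring]
  rw [habs] at h
  have : 2 / Real.pi * (Real.pi * |x|) = 2 * |x| := by field_simp
  linarith

/-- A Kusmin–Landau type bound for a slowly varying sequence of phases. -/
lemma norm_sum_unitPhase_le_of_diff (u : ℕ → ℝ) (m : ℕ) {Y B : ℝ} (hY : 0 < Y)
    (hlow : ∀ n < m, Y ≤ |u (n + 1) - u n|) (hupp : ∀ n < m, |u (n + 1) - u n| ≤ 1 / 2)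
    (hB : ∀ n < m, |(u (n + 2) - u (n + 1)) - (u (n + 1) - u n)| ≤ B) :
    ‖∑ n ∈ Finset.range m, unitPhase (u n)‖ ≤
      1 / (2 * Y) + m * (2 * Real.pi * B / (16 * Y ^ 2)) := by
  rcases m with _ | k
  · simp; positivity
  have hB0 : 0 ≤ B := (abs_nonneg _).trans (hB 0 (Nat.succ_pos k))
  set d : ℕ → ℂ := fun n => unitPhase (u (n + 1) - u n) - 1 with hd
  have hdlow : ∀ n < k + 1, 4 * Y ≤ ‖d n‖ := fun n hn =>
    (by linarith [hlow n hn] : 4 * Y ≤ 4 * |u (n + 1) - u n|).trans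
      (four_mul_abs_le_norm_unitPhase_sub_one (hupp n hn))
  have hdne : ∀ n < k + 1, d n ≠ 0 := fun n hn h => by
    have := hdlow n hn
    rw [h, norm_zero] at this
    linarith
  have hE : ∀ n < k + 1, unitPhase (u n) = (unitPhase (u (n + 1)) - unitPhase (u n)) * (d n)⁻¹ := by
    intro n hn
    have : unitPhase (u (n + 1)) - unitPhase (u n) = unitPhase (u n) * d n := by
      simp only [hd, mul_sub, ← unitPhase_add, mul_one]
      congr 2
      ring
    rw [this, mul_assoc, mul_inv_cancel₀ (hdne n hn), mul_one]
  have key : ∀ j < k + 1, ∑ n ∈ Finset.range (j + 1), unitPhase (u n) =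
      unitPhase (u (j + 1)) * (d j)⁻¹ - unitPhase (u 0) * (d 0)⁻¹
        - ∑ n ∈ Finset.range j, unitPhase (u (n + 1)) * ((d (n + 1))⁻¹ - (d n)⁻¹) := by
    intro j
    induction j with
    | zero =>
      intro h
      have := hE 0 h
      simp only [zero_add, Finset.sum_range_one, Finset.sum_range_zero, sub_zero]
      rw [← sub_mul]
      exact this
    | succ j ih =>
      intro h
      rw [Finset.sum_range_succ, ih (by omega), Finset.sum_range_succ _ j]
      have := hE (j + 1) h
      linear_combination this
  have hinv : ∀ n < k + 1, ‖(d n)⁻¹‖ ≤ 1 / (4 * Y) := by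
    intro n hn
    rw [norm_inv, one_div]
    exact inv_anti₀ (by positivity) (hdlow n hn)
  have hdiff : ∀ n < k, ‖unitPhase (u (n + 1)) * ((d (n + 1))⁻¹ - (d n)⁻¹)‖ ≤
      2 * Real.pi * B / (16 * Y ^ 2) := by
    intro n hn
    rw [norm_mul, norm_unitPhase, one_mul,
      inv_sub_inv (hdne (n + 1) (by omega)) (hdne n (by omega)), norm_div, norm_mul]
    have h1 : ‖d n - d (n + 1)‖ ≤ 2 * Real.pi * B := by
      have : d n - d (n + 1) =
          unitPhase (u (n + 1) - u n) - unitPhase (u (n + 2) - u (n + 1)) := by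
        simp only [hd]; ring
      rw [this]
      refine (norm_unitPhase_sub_le _ _).trans ?_
      rw [abs_sub_comm]
      exact mul_le_mul_of_nonneg_left (hB n (by omega)) Real.two_pi_pos.le
    have h2 : 16 * Y ^ 2 ≤ ‖d (n + 1)‖ * ‖d n‖ := by
      have := mul_le_mul (hdlow (n + 1) (by omega)) (hdlow n (by omega)) (by positivity)
        (norm_nonneg _)
      linarith
    exact div_le_div₀ (by positivity) h1 (by positivity) h2
  rw [key k (by omega)]
  have h1 : ‖unitPhase (u (k + 1)) * (d k)⁻¹‖ ≤ 1 / (4 * Y) := by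
    rw [norm_mul, norm_unitPhase, one_mul]
    exact hinv k (by omega)
  have h2 : ‖unitPhase (u 0) * (d 0)⁻¹‖ ≤ 1 / (4 * Y) := by
    rw [norm_mul, norm_unitPhase, one_mul]
    exact hinv 0 (by omega)
  have h3 := Finset.sum_le_sum fun n hn => hdiff n (Finset.mem_range.1 hn)
  have h4 := norm_sum_le (Finset.range k)
    fun n => unitPhase (u (n + 1)) * ((d (n + 1))⁻¹ - (d n)⁻¹)
  simp only [Finset.sum_const, Finset.card_range, nsmul_eq_mul] at h3
  have h5 : (k : ℝ) * (2 * Real.pi * B / (16 * Y ^ 2)) ≤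
      ((k + 1 : ℕ) : ℝ) * (2 * Real.pi * B / (16 * Y ^ 2)) := by
    gcongr
    omega
  have h6 : 1 / (2 * Y) = 1 / (4 * Y) + 1 / (4 * Y) := by field_simp; norm_num
  refine (norm_sub_le _ _).trans ?_
  linarith [norm_sub_le (unitPhase (u (k + 1)) * (d k)⁻¹) (unitPhase (u 0) * (d 0)⁻¹)]

/-- Expanding a mean square: correlations depending only on the distance of the indices. -/
lemma sum_norm_sq_sum_le {ι : Type*} (T : Finset ι) (f : ℕ → ι → ℂ) (R : ℕ) (c : ℕ → ℝ)
    (hc : ∀ b a, b + a < R → ‖∑ t ∈ T, f b t * (starRingEnd ℂ) (f (b + a) t)‖ ≤ c a) :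
    ∑ t ∈ T, ‖∑ b ∈ Finset.range R, f b t‖ ^ 2 ≤ 2 * R * ∑ a ∈ Finset.range R, c a := by
  have hc0 : ∀ a < R, 0 ≤ c a := fun a ha => (norm_nonneg _).trans (hc 0 a (by simpa using ha))
  set G : ℕ → ℕ → ℂ := fun b b' => ∑ t ∈ T, f b t * (starRingEnd ℂ) (f b' t) with hG
  have hsym : ∀ b b', ‖G b b'‖ = ‖G b' b‖ := by
    intro b b'
    rw [← Complex.norm_conj (G b b')]
    congr 1
    simp only [hG, map_sum, map_mul, Complex.conj_conj]
    exact Finset.sum_congr rfl fun _ _ => mul_comm _ _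
  have hexp : ((∑ t ∈ T, ‖∑ b ∈ Finset.range R, f b t‖ ^ 2 : ℝ) : ℂ) =
      ∑ b ∈ Finset.range R, ∑ b' ∈ Finset.range R, G b b' := by
    push_cast
    simp only [← Complex.mul_conj', map_sum, Finset.sum_mul_sum, hG]
    rw [Finset.sum_comm]
    exact Finset.sum_congr rfl fun b _ => Finset.sum_comm
  have hrow : ∀ b ∈ Finset.range R, ∑ b' ∈ Finset.range R, ‖G b b'‖ ≤
      2 * ∑ a ∈ Finset.range R, c a := by
    intro b hb
    have hb := Finset.mem_range.1 hb
    rw [← Finset.sum_range_add_sum_Ico _ hb.le]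
    have h1 : ∑ b' ∈ Finset.range b, ‖G b b'‖ ≤ ∑ a ∈ Finset.range R, c a := by
      rw [← Finset.sum_range_reflect]
      calc ∑ j ∈ Finset.range b, ‖G b (b - 1 - j)‖
          ≤ ∑ j ∈ Finset.range b, c (j + 1) := by
            refine Finset.sum_le_sum fun j hj => ?_
            have hj := Finset.mem_range.1 hj
            rw [hsym]
            have := hc (b - 1 - j) (j + 1) (by omega)
            rwa [show b - 1 - j + (j + 1) = b by omega] at this
        _ ≤ ∑ a ∈ Finset.range (b + 1), c a := by
            rw [Finset.sum_range_succ' c b]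
            linarith [hc0 0 (by omega)]
        _ ≤ _ := Finset.sum_le_sum_of_subset_of_nonneg
            (Finset.range_subset_range.2 (by omega)) fun a ha _ => hc0 a (Finset.mem_range.1 ha)
    have h2 : ∑ b' ∈ Finset.Ico b R, ‖G b b'‖ ≤ ∑ a ∈ Finset.range R, c a := by
      rw [Finset.sum_Ico_eq_sum_range]
      calc ∑ j ∈ Finset.range (R - b), ‖G b (b + j)‖
          ≤ ∑ j ∈ Finset.range (R - b), c j := by
            refine Finset.sum_le_sum fun j hj => ?_
            have hj := Finset.mem_range.1 hj
            exact hc b j (by omega)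
        _ ≤ _ := Finset.sum_le_sum_of_subset_of_nonneg
            (Finset.range_subset_range.2 (by omega)) fun a ha _ => hc0 a (Finset.mem_range.1 ha)
    linarith
  have hnn : 0 ≤ ∑ t ∈ T, ‖∑ b ∈ Finset.range R, f b t‖ ^ 2 :=
    Finset.sum_nonneg fun _ _ => by positivity
  calc ∑ t ∈ T, ‖∑ b ∈ Finset.range R, f b t‖ ^ 2
      = ‖((∑ t ∈ T, ‖∑ b ∈ Finset.range R, f b t‖ ^ 2 : ℝ) : ℂ)‖ := by
        rw [Complex.norm_real, Real.norm_of_nonneg hnn]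
    _ ≤ ∑ b ∈ Finset.range R, ∑ b' ∈ Finset.range R, ‖G b b'‖ := by
        rw [hexp]
        exact (norm_sum_le _ _).trans (Finset.sum_le_sum fun _ _ => norm_sum_le _ _)
    _ ≤ ∑ b ∈ Finset.range R, 2 * ∑ a ∈ Finset.range R, c a := Finset.sum_le_sum hrow
    _ = _ := by rw [Finset.sum_const, Finset.card_range, nsmul_eq_mul]; ring

/-- The van der Corput inequality. -/
lemma van_der_corput_inequality (z : ℕ → ℂ) (m R : ℕ) :
    (R : ℝ) * ‖∑ n ∈ Finset.range m, z n‖ ^ 2 ≤ 2 * (m + R) *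
      ∑ a ∈ Finset.range R, ‖∑ n ∈ Finset.range (m - a), z (n + a) * (starRingEnd ℂ) (z n)‖ := by
  rcases Nat.eq_zero_or_pos R with rfl | hR
  · simp
  set f : ℕ → ℕ → ℂ := fun b t => if b ≤ t ∧ t < b + m then z (t - b) else 0 with hf
  have hsum : ∀ b < R, ∑ t ∈ Finset.range (m + R), f b t = ∑ n ∈ Finset.range m, z n := by
    intro b hb
    rw [← Finset.sum_filter]
    have : (Finset.range (m + R)).filter (fun t => b ≤ t ∧ t < b + m) = Finset.Ico b (b + m) := by
      ext t
      simp only [Finset.mem_filter, Finset.mem_range, Finset.mem_Ico]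
      omega
    rw [this, Finset.sum_Ico_eq_sum_range]
    simp
  have hcorr : ∀ b a, b + a < R →
      ‖∑ t ∈ Finset.range (m + R), f b t * (starRingEnd ℂ) (f (b + a) t)‖ ≤
        ‖∑ n ∈ Finset.range (m - a), z (n + a) * (starRingEnd ℂ) (z n)‖ := by
    intro b a hab
    have h1 : ∀ t, f b t * (starRingEnd ℂ) (f (b + a) t) =
        if b + a ≤ t ∧ t < b + m then z (t - b) * (starRingEnd ℂ) (z (t - (b + a))) else 0 := by
      intro t
      simp only [hf]
      split_ifs <;> first | omega | simp
    simp only [h1]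
    rw [← Finset.sum_filter]
    have : (Finset.range (m + R)).filter (fun t => b + a ≤ t ∧ t < b + m) =
        Finset.Ico (b + a) (b + m) := by
      ext t
      simp only [Finset.mem_filter, Finset.mem_range, Finset.mem_Ico]
      omega
    rw [this, Finset.sum_Ico_eq_sum_range, show b + m - (b + a) = m - a by omega]
    refine le_of_eq (congrArg _ (Finset.sum_congr rfl fun n _ => ?_))
    rw [show b + a + n - b = n + a by omega, show b + a + n - (b + a) = n by omega]
  have h1 := sum_norm_sq_sum_le _ f R _ hcorr
  have h2 : (R : ℂ) * ∑ n ∈ Finset.range m, z n =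
      ∑ t ∈ Finset.range (m + R), ∑ b ∈ Finset.range R, f b t := by
    rw [Finset.sum_comm, Finset.sum_congr rfl fun b hb => hsum b (Finset.mem_range.1 hb)]
    simp
  have h3 : ((R : ℝ) * ‖∑ n ∈ Finset.range m, z n‖) ^ 2 ≤
      (m + R) * ∑ t ∈ Finset.range (m + R), ‖∑ b ∈ Finset.range R, f b t‖ ^ 2 := by
    have : (R : ℝ) * ‖∑ n ∈ Finset.range m, z n‖ =
        ‖∑ t ∈ Finset.range (m + R), ∑ b ∈ Finset.range R, f b t‖ := by
      rw [← h2, norm_mul, Complex.norm_natCast]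
    rw [this]
    refine (pow_le_pow_left₀ (norm_nonneg _) (norm_sum_le _ _) 2).trans ?_
    refine sq_sum_le_card_mul_sum_sq.trans_eq ?_
    rw [Finset.card_range]
    push_cast
    rfl
  have hR' : (0 : ℝ) < R := Nat.cast_pos.2 hR
  have h4 := h3.trans (mul_le_mul_of_nonneg_left h1 (by positivity))
  refine le_of_mul_le_mul_left ?_ hR'
  linarith

/-- The `(i+1)`-st forward differences of `u` on `[0, m)` have constant sign and size comparable
to `Y / N ^ i`, up to the factor `α`, for all `i < J`. -/
def HasDiffSize (J : ℕ) (α Y N : ℝ) (m : ℕ) (u : ℕ → ℝ) : Prop :=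
  ∀ i < J, ∃ s : ℝ, |s| = 1 ∧ ∀ n < m,
    Y / N ^ i ≤ s * (fwdDiff 1)^[i + 1] u n ∧ s * (fwdDiff 1)^[i + 1] u n ≤ α * (Y / N ^ i)

lemma HasDiffSize.mono {J J' : ℕ} {α Y N : ℝ} {m : ℕ} {u : ℕ → ℝ}
    (h : HasDiffSize J α Y N m u) (hJ : J' ≤ J) : HasDiffSize J' α Y N m u :=
  fun i hi => h i (hi.trans_le hJ)

lemma fwdDiff_iter_shift_sub (u : ℕ → ℝ) (a k n : ℕ) :
    (fwdDiff 1)^[k] (fun n => u (n + a) - u n) n =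
      (fwdDiff 1)^[k] u (n + a) - (fwdDiff 1)^[k] u n := by
  induction k generalizing n with
  | zero => rfl
  | succ k ih =>
    simp only [Function.iterate_succ_apply', fwdDiff] at ih ⊢
    rw [ih, ih, show n + 1 + a = n + a + 1 by ring]
    ring

lemma fwdDiff_iter_shift_sub_eq_sum (u : ℕ → ℝ) (a k n : ℕ) :
    (fwdDiff 1)^[k] (fun n => u (n + a) - u n) n =
      ∑ b ∈ Finset.range a, (fwdDiff 1)^[k + 1] u (n + b) := by
  rw [fwdDiff_iter_shift_sub]
  have := Finset.sum_range_sub (fun b => (fwdDiff 1)^[k] u (n + b)) a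
  simp only [add_zero] at this
  rw [← this]
  exact Finset.sum_congr rfl fun b _ => by rw [Function.iterate_succ_apply']; rfl

lemma HasDiffSize.shift_sub {J : ℕ} {α Y N : ℝ} {m : ℕ} {u : ℕ → ℝ}
    (h : HasDiffSize (J + 1) α Y N m u) (hN : N ≠ 0) (a : ℕ) :
    HasDiffSize J α (a * Y / N) N (m - a) (fun n => u (n + a) - u n) := by
  intro i hi
  obtain ⟨s, hs, hb⟩ := h (i + 1) (by omega)
  refine ⟨s, hs, fun n hn => ?_⟩
  rw [fwdDiff_iter_shift_sub_eq_sum, Finset.mul_sum]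
  have e1 : a * Y / N / N ^ i = ∑ b ∈ Finset.range a, Y / N ^ (i + 1) := by
    rw [Finset.sum_const, Finset.card_range, nsmul_eq_mul]
    field_simp
    ring
  rw [e1, Finset.mul_sum]
  constructor
  · refine Finset.sum_le_sum fun b hb' => (hb (n + b) ?_).1
    have := Finset.mem_range.1 hb'
    omega
  · refine Finset.sum_le_sum fun b hb' => (hb (n + b) ?_).2
    have := Finset.mem_range.1 hb'
    omega

lemma norm_sum_unitPhase_le_card (u : ℕ → ℝ) (m : ℕ) :
    ‖∑ n ∈ Finset.range m, unitPhase (u n)‖ ≤ m := by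
  refine (norm_sum_le _ _).trans ?_
  simp [norm_unitPhase]

lemma HasDiffSize.norm_sum_le_of_small {α Y N : ℝ} {m : ℕ} {u : ℕ → ℝ}
    (h : HasDiffSize 2 α Y N m u) (hα : 0 ≤ α) (hY : 0 < Y) (hN : 1 ≤ N) (hm : (m : ℝ) ≤ N)
    (hαY : α * Y ≤ 1 / 2) :
    ‖∑ n ∈ Finset.range m, unitPhase (u n)‖ ≤ (1 / 2 + Real.pi * α / 8) * (1 / Y) := by
  have hN0 : 0 < N := by linarith
  have habs : ∀ s x : ℝ, |s| = 1 → 0 ≤ s * x → |x| = s * x := fun s x hs hx => by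
    rw [← abs_of_nonneg hx, abs_mul, hs, one_mul]
  obtain ⟨s, hs, h1⟩ := h 0 (by norm_num)
  obtain ⟨t, ht, h2⟩ := h 1 (by norm_num)
  simp only [pow_zero, div_one, pow_one, Function.iterate_succ_apply', Function.iterate_zero,
    id, fwdDiff] at h1 h2
  have h1' : ∀ n < m, |u (n + 1) - u n| = s * (u (n + 1) - u n) := fun n hn =>
    habs s _ hs (hY.le.trans (h1 n hn).1)
  have h2' : ∀ n < m, |u (n + 1 + 1) - u (n + 1) - (u (n + 1) - u n)| =
      t * (u (n + 1 + 1) - u (n + 1) - (u (n + 1) - u n)) := fun n hn =>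
    habs t _ ht ((div_pos hY hN0).le.trans (h2 n hn).1)
  refine (norm_sum_unitPhase_le_of_diff u m (B := α * (Y / N)) hY
    (fun n hn => (h1' n hn) ▸ (h1 n hn).1)
    (fun n hn => (h1' n hn) ▸ ((h1 n hn).2.trans hαY))
    (fun n hn => (h2' n hn) ▸ (h2 n hn).2)).trans ?_
  have h3 : (m : ℝ) * (2 * Real.pi * (α * (Y / N)) / (16 * Y ^ 2)) ≤
      N * (2 * Real.pi * (α * (Y / N)) / (16 * Y ^ 2)) := by
    have := Real.pi_pos
    gcongr
  refine (add_le_add_right h3 _).trans_eq ?_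
  field_simp
  ring

/-- The exponential sum bound `N ^ ε * (N * (Y / N ^ j) ^ κ + 1 / Y)` for sequences whose first
`j + 2` differences are of the expected size. -/
def ExpSumBound (α ε : ℝ) (j : ℕ) (κ : ℝ) : Prop :=
  ∃ C : ℝ, 0 ≤ C ∧ ∀ (N Y : ℝ) (m : ℕ) (u : ℕ → ℝ), 1 ≤ N → 0 < Y → (m : ℝ) ≤ N →
    HasDiffSize (j + 2) α Y N m u →
    ‖∑ n ∈ Finset.range m, unitPhase (u n)‖ ≤ C * N ^ ε * (N * (Y / N ^ j) ^ κ + 1 / Y)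

lemma expSumBound_zero {α ε κ : ℝ} (hα : 0 < α) (hε : 0 ≤ ε) (hκ : 0 ≤ κ) :
    ExpSumBound α ε 0 κ := by
  have hpi := Real.pi_pos
  refine ⟨max (1 / 2 + Real.pi * α / 8) ((2 * α) ^ κ), by positivity, ?_⟩
  intro N Y m u hN hY hm h
  set C := max (1 / 2 + Real.pi * α / 8) ((2 * α) ^ κ) with hC
  have hC0 : 0 ≤ C := by positivity
  have hNε : 1 ≤ N ^ ε := Real.one_le_rpow hN hε
  have hN0 : 0 < N := by linarith
  rw [pow_zero, div_one]
  have hT : 0 ≤ N * Y ^ κ + 1 / Y := by positivity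
  suffices hs : ‖∑ n ∈ Finset.range m, unitPhase (u n)‖ ≤ C * (N * Y ^ κ + 1 / Y) by
    refine hs.trans ?_
    rw [mul_assoc, mul_comm (N ^ ε), ← mul_assoc]
    exact le_mul_of_one_le_right (by positivity) hNε
  rcases le_total (α * Y) (1 / 2) with hs | hs
  · refine (h.norm_sum_le_of_small hα.le hY hN hm hs).trans ?_
    have : 0 ≤ N * Y ^ κ := by positivity
    exact mul_le_mul (le_max_left _ _) (by linarith) (by positivity) hC0
  · refine (norm_sum_unitPhase_le_card u m).trans (hm.trans ?_)
    have h1 : 1 ≤ (2 * α) ^ κ * Y ^ κ := by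
      rw [← Real.mul_rpow (by positivity) hY.le]
      exact Real.one_le_rpow (by linarith) hκ
    have h2 : (2 * α) ^ κ * Y ^ κ ≤ C * Y ^ κ :=
      mul_le_mul_of_nonneg_right (le_max_right _ _) (by positivity)
    have h3 : N * 1 ≤ N * (C * Y ^ κ) := mul_le_mul_of_nonneg_left (h1.trans h2) hN0.le
    have h4 : 0 ≤ C * (1 / Y) := by positivity
    nlinarith

lemma sum_range_one_div_le_one_add_log (R : ℕ) :
    ∑ i ∈ Finset.range R, 1 / ((i : ℝ) + 1) ≤ 1 + Real.log R := by
  refine le_of_eq_of_le ?_ (harmonic_le_one_add_log R)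
  simp [harmonic]

lemma exists_one_add_log_le_rpow {ε : ℝ} (hε : 0 < ε) (A : ℝ) (hA : 0 < A) :
    ∃ C : ℝ, 0 ≤ C ∧ ∀ N : ℝ, 1 ≤ N → ∀ R : ℝ, 1 ≤ R → R ≤ A * N → 1 + Real.log R ≤ C * N ^ ε := by
  refine ⟨1 + A ^ ε / ε, by positivity, fun N hN R hR hRN => ?_⟩
  have h1 := Real.log_le_rpow_div (x := R) (by linarith) hε
  have h2 : R ^ ε ≤ A ^ ε * N ^ ε := by
    rw [← Real.mul_rpow hA.le (by linarith)]
    exact Real.rpow_le_rpow (by linarith) hRN hε.le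
  have h3 : 1 ≤ N ^ ε := Real.one_le_rpow hN hε.le
  have h4 : R ^ ε / ε ≤ A ^ ε * N ^ ε / ε := by gcongr
  have h5 : A ^ ε * N ^ ε / ε = A ^ ε / ε * N ^ ε := by ring
  nlinarith

set_option maxHeartbeats 1000000 in
/-- Differencing (van der Corput's A-process) applied to an exponential sum bound. -/
lemma ExpSumBound.succ {α ε κ : ℝ} {j : ℕ} (hα : 1 ≤ α) (hε : 0 < ε) (hκ : 0 < κ)
    (hjκ : j * κ ≤ 1) (h : ExpSumBound α ε j κ) : ExpSumBound α ε (j + 1) (κ / (2 * κ + 2)) := by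
  have hpi := Real.pi_pos
  obtain ⟨C, hC0, hC⟩ := h
  obtain ⟨L, hL0, hL⟩ := exists_one_add_log_le_rpow hε (2 * α) (by linarith)
  set E : ℝ := 2 * (1 + 2 * α) * (C + 2 * (2 * α * C * L + 1)) with hE
  set K : ℝ := 1 / 2 + Real.pi * α / 8 with hK
  have hK0 : 0 ≤ K := by positivity
  have hE0 : 0 ≤ E := by positivity
  refine ⟨1 + E + K, by positivity, ?_⟩
  intro N Y m u hN hY hm hu
  have hN0 : 0 < N := by linarith
  have hNε : 1 ≤ N ^ ε := Real.one_le_rpow hN hε.le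
  set W : ℝ := Y / N ^ (j + 1) with hW
  have hW0 : 0 < W := by positivity
  set ν : ℝ := κ / (2 * κ + 2) with hν
  have hν0 : 0 < ν := by positivity
  have hWν : 0 < W ^ ν := by positivity
  have hYi : 0 < 1 / Y := by positivity
  rcases le_total (α * Y) (1 / 2) with hs | hs
  · refine ((hu.mono (by omega)).norm_sum_le_of_small (by linarith) hY hN hm hs).trans ?_
    have h1 : 1 / Y ≤ N * W ^ ν + 1 / Y := by linarith [mul_pos hN0 hWν]
    have h2 : K ≤ (1 + E + K) * N ^ ε := by nlinarith
    exact mul_le_mul h2 h1 hYi.le (by positivity)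
  suffices hmain : ‖∑ n ∈ Finset.range m, unitPhase (u n)‖ ≤ (1 + E) * N ^ ε * (N * W ^ ν) by
    refine hmain.trans (mul_le_mul ?_ (by linarith) (by positivity) (by positivity))
    exact mul_le_mul_of_nonneg_right (by linarith) (by positivity)
  rcases le_total 1 W with hW1 | hW1
  · refine (norm_sum_unitPhase_le_card u m).trans (hm.trans ?_)
    have h1 : 1 ≤ W ^ ν := Real.one_le_rpow hW1 hν0.le
    have h2 : 1 ≤ (1 + E) * N ^ ε := one_le_mul_of_one_le_of_one_le (by linarith) hNε
    have h3 : N ≤ N * W ^ ν := le_mul_of_one_le_right hN0.le h1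
    exact h3.trans (le_mul_of_one_le_left (by positivity) h2)
  set θ : ℝ := κ / (1 + κ) with hθ
  have hθ0 : 0 < θ := by positivity
  have hθ1 : θ ≤ 1 := by
    rw [hθ, div_le_one (by linarith)]
    linarith
  set V : ℝ := W ^ θ with hV
  have hV0 : 0 < V := by positivity
  have hV1 : V ≤ 1 := Real.rpow_le_one hW0.le hW1 hθ0.le
  have hWV : (W / V) ^ κ = V := by
    have : W / V = W ^ (1 - θ) := by rw [Real.rpow_sub hW0, Real.rpow_one]
    rw [this, ← Real.rpow_mul hW0.le, hV]
    congr 1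
    rw [hθ]
    field_simp
    ring
  have hYα : 1 ≤ 2 * α * Y := by linarith
  have hVN : 1 / V ≤ 2 * α * N := by
    have h1 : 1 / W ≤ 2 * α * N ^ (j + 1) := by
      rw [hW, one_div_div, div_le_iff₀ hY]
      have : 0 < N ^ (j + 1) := by positivity
      nlinarith
    have h2 : (1 / W) ^ θ ≤ (2 * α * N ^ (j + 1)) ^ θ :=
      Real.rpow_le_rpow (by positivity) h1 hθ0.le
    rw [Real.div_rpow zero_le_one hW0.le, Real.one_rpow,
      Real.mul_rpow (by positivity) (by positivity), ← Real.rpow_natCast,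
      ← Real.rpow_mul hN0.le] at h2
    refine h2.trans (mul_le_mul ?_ ?_ (by positivity) (by positivity))
    · exact Real.rpow_le_self_of_one_le (by linarith) hθ1
    · refine Real.rpow_le_self_of_one_le hN ?_
      rw [hθ, mul_div_assoc', div_le_one (by linarith)]
      push_cast
      linarith
  set R : ℕ := ⌊1 / V⌋₊ with hR
  have hV1' : 1 ≤ 1 / V := by rwa [le_div_iff₀ hV0, one_mul]
  have hR1 : 1 ≤ R := Nat.le_floor (by simpa using hV1')
  have hR1' : (1 : ℝ) ≤ R := by exact_mod_cast hR1
  have hRV : (R : ℝ) ≤ 1 / V := Nat.floor_le (by positivity)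
  have hVR : 1 ≤ 2 * V * R := by
    have h1 := Nat.lt_floor_add_one (1 / V)
    rw [← hR, div_lt_iff₀ hV0] at h1
    nlinarith
  have hvdc := van_der_corput_inequality (fun n => unitPhase (u n)) m R
  simp only [unitPhase_mul_conj] at hvdc
  have hSa : ∀ i < R, ‖∑ n ∈ Finset.range (m - (i + 1)), unitPhase (u (n + (i + 1)) - u n)‖ ≤
      C * N ^ ε * (N * V + 2 * α * N * (1 / ((i : ℝ) + 1))) := by
    intro i hi
    have hi' : ((i : ℝ) + 1) ≤ 1 / V := by
      refine le_trans ?_ hRV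
      exact_mod_cast hi
    have hma : ((m - (i + 1) : ℕ) : ℝ) ≤ N := by
      refine le_trans ?_ hm
      exact_mod_cast Nat.sub_le _ _
    have := hC N (((i + 1 : ℕ) : ℝ) * Y / N) (m - (i + 1)) _ hN (by positivity) hma
      (hu.shift_sub hN0.ne' (i + 1))
    refine this.trans ?_
    push_cast
    have h1 : (((i : ℝ) + 1) * Y / N / N ^ j) ^ κ ≤ V := by
      rw [← hWV]
      refine Real.rpow_le_rpow (by positivity) ?_ hκ.le
      have : ((i : ℝ) + 1) * Y / N / N ^ j = ((i : ℝ) + 1) * W := by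
        rw [hW]
        field_simp
        ring
      rw [this, div_eq_mul_one_div, mul_comm W]
      gcongr
    have h2 : 1 / (((i : ℝ) + 1) * Y / N) ≤ 2 * α * N * (1 / ((i : ℝ) + 1)) := by
      have : 2 * α * N * (1 / ((i : ℝ) + 1)) = 2 * α * Y * (1 / (((i : ℝ) + 1) * Y / N)) := by
        field_simp
      rw [this]
      exact le_mul_of_one_le_left (by positivity) hYα
    gcongr
  have hsum : ∑ a ∈ Finset.range R, ‖∑ n ∈ Finset.range (m - a), unitPhase (u (n + a) - u n)‖ ≤
      N * (C * N ^ ε * (R * V) + (2 * α * C * L + 1) * N ^ (2 * ε)) := by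
    have h0 : ∑ a ∈ Finset.range R, ‖∑ n ∈ Finset.range (m - a), unitPhase (u (n + a) - u n)‖ ≤
        ∑ a ∈ Finset.range (R + 1), ‖∑ n ∈ Finset.range (m - a), unitPhase (u (n + a) - u n)‖ := by
      rw [Finset.sum_range_succ]
      linarith [norm_nonneg (∑ n ∈ Finset.range (m - R), unitPhase (u (n + R) - u n))]
    rw [Finset.sum_range_succ'] at h0
    have h1 : ‖∑ n ∈ Finset.range (m - 0), unitPhase (u (n + 0) - u n)‖ ≤ N :=
      (norm_sum_unitPhase_le_card (fun n => u (n + 0) - u n) m).trans hm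
    have h2 := Finset.sum_le_sum fun i hi => hSa i (Finset.mem_range.1 hi)
    rw [← Finset.mul_sum, Finset.sum_add_distrib, Finset.sum_const, Finset.card_range,
      nsmul_eq_mul, ← Finset.mul_sum] at h2
    have h3 := (sum_range_one_div_le_one_add_log R).trans (hL N hN R hR1' (hRV.trans hVN))
    have h4 : C * N ^ ε * (R * (N * V) + 2 * α * N * ∑ i ∈ Finset.range R, 1 / ((i : ℝ) + 1)) ≤
        C * N ^ ε * (R * (N * V) + 2 * α * N * (L * N ^ ε)) := by gcongr
    have h5 : N ^ (2 * ε) = N ^ ε * N ^ ε := by rw [← Real.rpow_add hN0]; ring_nf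
    have h6 : N ≤ N * (N ^ ε * N ^ ε) :=
      le_mul_of_one_le_right hN0.le (one_le_mul_of_one_le_of_one_le hNε hNε)
    rw [h5]
    calc _ ≤ _ := h0
      _ ≤ C * N ^ ε * (R * (N * V) + 2 * α * N * (L * N ^ ε)) + N * (N ^ ε * N ^ ε) := by linarith
      _ = _ := by ring
  have hmR : (m : ℝ) + R ≤ (1 + 2 * α) * N := by linarith [hRV.trans hVN]
  have hfin : ‖∑ n ∈ Finset.range m, unitPhase (u n)‖ ^ 2 ≤
      E * (N ^ (2 * ε) * N ^ 2 * V) := by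
    refine le_of_mul_le_mul_left ?_ (by linarith : (0 : ℝ) < R)
    have h1 : N ^ ε ≤ N ^ (2 * ε) := Real.rpow_le_rpow_of_exponent_le hN (by linarith)
    have h2 : 0 ≤ 2 * α * C * L + 1 := by positivity
    calc _ ≤ _ := hvdc
      _ ≤ 2 * ((1 + 2 * α) * N) *
          (N * (C * N ^ ε * (R * V) + (2 * α * C * L + 1) * N ^ (2 * ε))) := by gcongr
      _ ≤ 2 * ((1 + 2 * α) * N) *
          (N * (C * N ^ (2 * ε) * (R * V) + (2 * α * C * L + 1) * N ^ (2 * ε) * (2 * V * R))) := by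
        have : (2 * α * C * L + 1) * N ^ (2 * ε) ≤
            (2 * α * C * L + 1) * N ^ (2 * ε) * (2 * V * R) :=
          le_mul_of_one_le_right (by positivity) hVR
        gcongr
      _ = _ := by rw [hE]; ring
  rw [← sq_le_sq₀ (norm_nonneg _) (by positivity)]
  refine hfin.trans ?_
  have e1 : ((1 + E) * N ^ ε * (N * W ^ ν)) ^ 2 = (1 + E) ^ 2 * (N ^ (2 * ε) * N ^ 2 * V) := by
    have a1 : N ^ (2 * ε) = N ^ ε * N ^ ε := by rw [← Real.rpow_add hN0]; ring_nf
    have a2 : V = W ^ ν * W ^ ν := by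
      rw [← Real.rpow_add hW0, hV, hθ, hν]
      congr 1
      field_simp
      ring
    rw [a1, a2]
    ring
  rw [e1]
  gcongr
  nlinarith

/-- The bounds obtained by iterated differencing from the trivial estimate. -/
lemma expSumBound_iterate {α ε A : ℝ} (hα : 1 ≤ α) (hε : 0 < ε) (hA : 0 < A) (j : ℕ) :
    ExpSumBound α ε j (1 / (2 ^ j * (A + 2) - 2)) := by
  induction j with
  | zero =>
    have : (1 : ℝ) / (2 ^ 0 * (A + 2) - 2) = 1 / A := by congr 1; ring
    rw [this]
    exact expSumBound_zero (by linarith) hε.le (by positivity)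
  | succ j ih =>
    have h1 : (j : ℝ) + 1 ≤ 2 ^ j := by exact_mod_cast j.lt_two_pow_self
    have h2 : 0 < (2 : ℝ) ^ j * (A + 2) - 2 := by
      have : (1 : ℝ) ≤ 2 ^ j := one_le_pow₀ (by norm_num)
      nlinarith
    have h3 := ih.succ hα hε (by positivity) (by
      rw [mul_one_div, div_le_one h2]
      nlinarith [mul_pos (by positivity : (0 : ℝ) < 2 ^ j) hA])
    have h4 : (2 : ℝ) ^ (j + 1) * (A + 2) - 2 = 2 * (2 ^ j * (A + 2) - 2) + 2 := by
      rw [pow_succ]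
      ring
    rw [h4]
    generalize (2 : ℝ) ^ j * (A + 2) - 2 = D at h2 h3 ⊢
    convert h3 using 1
    field_simp
    ring

lemma exists_fwdDiff_iter_eq_of_hasDerivAt (k : ℕ) : ∀ g : ℕ → ℝ → ℝ,
    (∀ i, ∀ y > 0, HasDerivAt (g i) (g (i + 1) y) y) → ∀ x : ℝ, 0 < x →
    ∃ ξ, x ≤ ξ ∧ ξ ≤ x + k ∧ (fwdDiff (1 : ℝ))^[k] (g 0) x = g k ξ := by
  induction k with
  | zero => exact fun g _ x _ => ⟨x, le_rfl, by simp, rfl⟩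
  | succ k ih =>
    intro g hg x hx
    obtain ⟨ξ, h1, h2, h3⟩ := ih (fun i => fwdDiff 1 (g i)) (fun i y hy => by
      have := (hg i (y + 1) (by linarith)).comp_add_const y 1
      exact this.sub (hg i y hy)) x hx
    have hξ : 0 < ξ := hx.trans_le h1
    obtain ⟨η, hη, h4⟩ := exists_hasDerivAt_eq_slope (g k) (g (k + 1)) (lt_add_one ξ)
      (fun y hy => (hg k y (by linarith [hy.1])).continuousAt.continuousWithinAt)
      (fun y hy => hg k y (by linarith [hy.1]))
    refine ⟨η, by linarith [hη.1], by push_cast; linarith [hη.2], ?_⟩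
    rw [Function.iterate_succ_apply, h3, h4, add_sub_cancel_left, div_one]
    rfl

/-- The coefficient `r (r - 1) ⋯ (r - i + 1)` of the `i`-th derivative of `x ^ r`. -/
noncomputable def rpowDerivCoeff (r : ℝ) (i : ℕ) : ℝ := ∏ t ∈ Finset.range i, (r - t)

lemma exists_fwdDiff_iter_rpow_eq (r : ℝ) (k : ℕ) {x : ℝ} (hx : 0 < x) :
    ∃ ξ, x ≤ ξ ∧ ξ ≤ x + k ∧
      (fwdDiff (1 : ℝ))^[k] (fun y => y ^ r) x = rpowDerivCoeff r k * ξ ^ (r - k) := by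
  have := exists_fwdDiff_iter_eq_of_hasDerivAt k
    (fun i y => rpowDerivCoeff r i * y ^ (r - i)) (fun i y hy => by
      have h := (Real.hasDerivAt_rpow_const (x := y) (p := r - i) (Or.inl hy.ne')).const_mul
        (rpowDerivCoeff r i)
      refine h.congr_deriv ?_
      rw [show rpowDerivCoeff r (i + 1) = rpowDerivCoeff r i * (r - i) from
        Finset.prod_range_succ _ _, mul_assoc]
      push_cast
      rw [sub_sub]) x hx
  simpa [rpowDerivCoeff] using this

lemma fwdDiff_iter_comp_add_natCast (f : ℝ → ℝ) (c x : ℝ) (k n : ℕ) :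
    (fwdDiff 1)^[k] (fun n : ℕ => c * f (x + n)) n = c * (fwdDiff (1 : ℝ))^[k] f (x + n) := by
  induction k generalizing n with
  | zero => rfl
  | succ k ih =>
    simp only [Function.iterate_succ_apply', fwdDiff] at ih ⊢
    rw [ih, ih]
    push_cast
    rw [← add_assoc]
    ring

lemma exists_bounds_of_pos (f : ℕ → ℝ) (hf : ∀ i, 0 < f i) (J : ℕ) :
    ∃ lo hi : ℝ, 0 < lo ∧ ∀ i < J, lo ≤ f i ∧ f i ≤ hi := by
  induction J with
  | zero => exact ⟨1, 1, one_pos, by simp⟩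
  | succ J ih =>
    obtain ⟨lo, hi, h0, h⟩ := ih
    refine ⟨min lo (f J), max hi (f J), lt_min h0 (hf J), fun i hi => ?_⟩
    rcases Nat.lt_succ_iff_lt_or_eq.1 hi with h' | rfl
    · exact ⟨(min_le_left _ _).trans (h i h').1, (h i h').2.trans (le_max_left _ _)⟩
    · exact ⟨min_le_right _ _, le_max_right _ _⟩

lemma rpow_bounds_of_abs_le {t B s w : ℝ} (ht : 1 ≤ t) (htB : t ≤ B) (hs : |s| ≤ w) :
    B ^ (-w) ≤ t ^ s ∧ t ^ s ≤ B ^ w := by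
  have hw : 0 ≤ w := (abs_nonneg s).trans hs
  obtain ⟨h1, h2⟩ := abs_le.1 hs
  constructor
  · calc B ^ (-w) ≤ t ^ (-w) :=
        Real.rpow_le_rpow_of_nonpos (by linarith) htB (by linarith)
      _ ≤ t ^ s := Real.rpow_le_rpow_of_exponent_le ht h1
  · calc t ^ s ≤ t ^ w := Real.rpow_le_rpow_of_exponent_le ht h2
      _ ≤ B ^ w := Real.rpow_le_rpow (by linarith) htB hw

/-- The sequences `c * (M + n) ^ r` on a dyadic block have differences of the expected size. -/
lemma exists_hasDiffSize_rpow {r : ℝ} (hr : 0 < r) (hri : ∀ m : ℤ, r ≠ m) (J : ℕ) :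
    ∃ b α : ℝ, 0 < b ∧ 1 ≤ α ∧ ∀ (c : ℝ) (M m : ℕ), 0 < c → 1 ≤ M → m ≤ M →
      HasDiffSize J α (b * (c * (M : ℝ) ^ (r - 1))) M m (fun n => c * ((M : ℝ) + n) ^ r) := by
  have hne : ∀ i, 0 < |rpowDerivCoeff r (i + 1)| := fun i =>
    abs_pos.2 (Finset.prod_ne_zero_iff.2 fun t _ => sub_ne_zero.2 (by exact_mod_cast hri t))
  obtain ⟨lo, hi, hlo, hb⟩ := exists_bounds_of_pos _ hne J
  set B : ℝ := J + 3 with hB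
  set w : ℝ := r + J with hw
  have hB0 : 0 < B := by positivity
  have hb0 : 0 < lo * B ^ (-w) := by positivity
  refine ⟨lo * B ^ (-w), max 1 (hi * B ^ w / (lo * B ^ (-w))), hb0, le_max_left _ _, ?_⟩
  intro c M m hc hM hm i hiJ
  have hM0 : (0 : ℝ) < M := by exact_mod_cast hM
  have hM1 : (1 : ℝ) ≤ M := by exact_mod_cast hM
  have hsg : |(SignType.sign (rpowDerivCoeff r (i + 1)) : ℝ)| = 1 := by
    have : rpowDerivCoeff r (i + 1) ≠ 0 := abs_pos.1 (hne i)
    rcases this.lt_or_gt with h | h <;> simp [h]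
  refine ⟨SignType.sign (rpowDerivCoeff r (i + 1)), hsg, fun n hn => ?_⟩
  rw [fwdDiff_iter_comp_add_natCast (fun y => y ^ r)]
  obtain ⟨ξ, h1, h2, h3⟩ := exists_fwdDiff_iter_rpow_eq r (i + 1) (x := M + n) (by positivity)
  rw [h3]
  have hn' : (n : ℝ) ≤ M := by exact_mod_cast hn.le.trans hm
  have hi' : ((i + 1 : ℕ) : ℝ) ≤ J := by exact_mod_cast hiJ
  have hξM : (M : ℝ) ≤ ξ := by linarith [(Nat.cast_nonneg n : (0 : ℝ) ≤ n)]
  have hξB : ξ ≤ B * M := by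
    have : (J : ℝ) ≤ J * M := le_mul_of_one_le_right (by positivity) hM1
    rw [hB]
    linarith
  have hs : |r - ((i + 1 : ℕ) : ℝ)| ≤ w := by
    rw [abs_le, hw]
    constructor <;> linarith [(Nat.cast_nonneg (i + 1) : (0 : ℝ) ≤ ((i + 1 : ℕ) : ℝ))]
  obtain ⟨k1, k2⟩ := rpow_bounds_of_abs_le (t := ξ / M) (by rwa [le_div_iff₀ hM0, one_mul])
    (by rwa [div_le_iff₀ hM0]) hs
  obtain ⟨l1, l2⟩ := hb i hiJ
  have hMp : (M : ℝ) ^ (r - ((i + 1 : ℕ) : ℝ)) = M ^ (r - 1) / M ^ i := by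
    rw [← Real.rpow_natCast, ← Real.rpow_sub hM0]
    congr 1
    push_cast
    ring
  have hval : (SignType.sign (rpowDerivCoeff r (i + 1)) : ℝ) *
      (c * (rpowDerivCoeff r (i + 1) * ξ ^ (r - ((i + 1 : ℕ) : ℝ)))) =
      |rpowDerivCoeff r (i + 1)| * (ξ / M) ^ (r - ((i + 1 : ℕ) : ℝ)) *
        (c * (M ^ (r - 1) / M ^ i)) := by
    rw [← hMp, Real.div_rpow (by linarith) hM0.le, ← sign_mul_self]
    field_simp
  rw [hval]
  set X : ℝ := c * (M ^ (r - 1) / M ^ i) with hX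
  have hX0 : 0 < X := by positivity
  have hXe : lo * B ^ (-w) * (c * (M : ℝ) ^ (r - 1)) / M ^ i = lo * B ^ (-w) * X := by
    rw [hX]; ring
  rw [hXe]
  have hBw : 0 < B ^ (-w) := by positivity
  constructor
  · gcongr
  · rw [← mul_assoc (max 1 _)]
    refine mul_le_mul_of_nonneg_right ?_ hX0.le
    calc _ ≤ hi * B ^ w := mul_le_mul l2 k2 (hBw.le.trans k1) ((abs_nonneg _).trans l2)
      _ = hi * B ^ w / (lo * B ^ (-w)) * (lo * B ^ (-w)) := by field_simp
      _ ≤ _ := by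
        gcongr
        exact le_max_right _ _

/-- Fejér's kernel bounds the number of terms in a short interval modulo one. -/
lemma card_le_sum_norm_sum_unitPhase (x : ℕ → ℝ) (m P : ℕ) (hP : 1 ≤ P) (β : ℝ)
    (S : Finset ℕ) (hS : S ⊆ Finset.range m)
    (hx : ∀ n ∈ S, ∃ k : ℤ, 0 ≤ x n - β - k ∧ x n - β - k ≤ 1 / (6 * P)) :
    (S.card : ℝ) ≤ 8 / P *
      ∑ a ∈ Finset.range P, ‖∑ n ∈ Finset.range m, unitPhase (a * x n)‖ := by
  have hP0 : (0 : ℝ) < P := by exact_mod_cast hP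
  have hpi := Real.pi_pos
  have h1 := sum_norm_sq_sum_le (Finset.range m) (fun b t => unitPhase (b * (x t - β))) P
    (fun a => ‖∑ n ∈ Finset.range m, unitPhase (a * x n)‖) (by
      intro b a _
      have : ∀ t, unitPhase (b * (x t - β)) *
          (starRingEnd ℂ) (unitPhase ((b + a : ℕ) * (x t - β))) =
          unitPhase (a * β) * (starRingEnd ℂ) (unitPhase (a * x t)) := by
        intro t
        rw [unitPhase_mul_conj, unitPhase_mul_conj]
        push_cast
        ring_nf
      simp only [this]
      rw [← Finset.mul_sum, ← map_sum, norm_mul, norm_unitPhase, one_mul, Complex.norm_conj])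
  have h2 : ∀ t ∈ S, (P / 2 : ℝ) ^ 2 ≤
      ‖∑ b ∈ Finset.range P, unitPhase (b * (x t - β))‖ ^ 2 := by
    intro t ht
    obtain ⟨k, hk0, hk1⟩ := hx t ht
    refine pow_le_pow_left₀ (by positivity) (le_trans ?_ (Complex.re_le_norm _)) 2
    rw [Complex.re_sum]
    have : ∀ b ∈ Finset.range P, (1 / 2 : ℝ) ≤ (unitPhase (b * (x t - β))).re := by
      intro b hb
      have hb : (b : ℝ) ≤ P := by exact_mod_cast (Finset.mem_range.1 hb).le
      have e1 : unitPhase (b * (x t - β)) = unitPhase (b * (x t - β - k)) := by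
        have : b * (x t - β) = b * (x t - β - k) + ((b * k : ℤ) : ℝ) := by push_cast; ring
        rw [this, unitPhase_add, unitPhase_intCast, mul_one]
      rw [e1, unitPhase, mul_comm, Complex.exp_ofReal_mul_I_re, ← Real.cos_pi_div_three]
      refine Real.cos_le_cos_of_nonneg_of_le_pi (by positivity) (by linarith) ?_
      have : b * (x t - β - k) ≤ P * (1 / (6 * P)) := by gcongr
      have e2 : (P : ℝ) * (1 / (6 * P)) = 1 / 6 := by field_simp
      nlinarith
    have := Finset.sum_le_sum this
    rw [Finset.sum_const, Finset.card_range, nsmul_eq_mul] at this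
    linarith
  have h3 : (S.card : ℝ) * (P / 2) ^ 2 ≤ 2 * P *
      ∑ a ∈ Finset.range P, ‖∑ n ∈ Finset.range m, unitPhase (a * x n)‖ := by
    rw [← nsmul_eq_mul, ← Finset.sum_const]
    exact ((Finset.sum_le_sum h2).trans (Finset.sum_le_sum_of_subset_of_nonneg hS
      fun _ _ _ => by positivity)).trans h1
  rw [div_mul_eq_mul_div, le_div_iff₀ hP0]
  refine le_of_mul_le_mul_right ?_ hP0
  linarith

lemma rpow_mul_le_rpow_of_balance {M Z P H D : ℝ} (hD : 16 ≤ D) (hM : 1 ≤ M) (hMZ : M ≤ Z)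
    (hH : 1 ≤ H) (hP : P ≤ H * M ^ (2 * (1 / D ^ 2))) (hbal : H ^ (D - 1) = M * (P * Z)) :
    M ^ (1 / D ^ 2) * H ≤ Z ^ (2 / (D - 3)) := by
  set ε : ℝ := 1 / D ^ 2 with hε
  have hε0 : 0 < ε := by positivity
  have hH0 : 0 < H := by linarith
  have hM0 : 0 < M := by linarith
  have hZ0 : 0 < Z := by linarith
  have hZ1 : 1 ≤ Z := hM.trans hMZ
  have h1 : H ^ (D - 2) ≤ Z ^ (2 + 2 * ε) := by
    refine le_of_mul_le_mul_right ?_ hH0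
    calc H ^ (D - 2) * H = H ^ (D - 1) := by
          nth_rewrite 2 [← Real.rpow_one H]
          rw [← Real.rpow_add hH0]
          ring_nf
      _ = M * (P * Z) := hbal
      _ ≤ M * (H * Z ^ (2 * ε) * Z) := by
        have : M ^ (2 * ε) ≤ Z ^ (2 * ε) := Real.rpow_le_rpow hM0.le hMZ (by positivity)
        have : P ≤ H * Z ^ (2 * ε) := hP.trans (by gcongr)
        gcongr
      _ ≤ Z * (H * Z ^ (2 * ε) * Z) := by gcongr
      _ = Z ^ (2 + 2 * ε) * H := by
        rw [Real.rpow_add hZ0, show (2 : ℝ) = ((2 : ℕ) : ℝ) by norm_num, Real.rpow_natCast]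
        ring
  have h2 : H ≤ Z ^ ((2 + 2 * ε) / (D - 2)) := by
    have h3 := Real.rpow_le_rpow (by positivity) h1 (by
      have : 0 < D - 2 := by linarith
      positivity : 0 ≤ 1 / (D - 2))
    rw [← Real.rpow_mul hH0.le, ← Real.rpow_mul hZ0.le, mul_one_div, mul_one_div,
      div_self (by linarith), Real.rpow_one] at h3
    exact h3
  calc M ^ ε * H ≤ Z ^ ε * Z ^ ((2 + 2 * ε) / (D - 2)) := by
        have : M ^ ε ≤ Z ^ ε := Real.rpow_le_rpow hM0.le hMZ hε0.le
        gcongr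
    _ = Z ^ (ε + (2 + 2 * ε) / (D - 2)) := (Real.rpow_add hZ0 _ _).symm
    _ ≤ _ := by
      refine Real.rpow_le_rpow_of_exponent_le hZ1 ?_
      have a1 : 0 < D - 2 := by linarith
      have a2 : 0 < D - 3 := by linarith
      have a3 : ε + (2 + 2 * ε) / (D - 2) = 2 / (D - 2) + 1 / (D * (D - 2)) := by
        rw [hε]
        field_simp
        ring
      have a4 : 2 / (D - 3) = 2 / (D - 2) + 2 / ((D - 3) * (D - 2)) := by
        field_simp
        ring
      rw [a3, a4]
      have a5 : 1 / (D * (D - 2)) ≤ 2 / ((D - 3) * (D - 2)) := by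
        gcongr
        · norm_num
        · linarith
      linarith

lemma exists_int_floor_modEq {e l : ℕ} (he : 1 ≤ e) {y : ℝ} (hy : 0 ≤ y)
    (h : ⌊y⌋₊ ≡ l [MOD e]) :
    ∃ k : ℤ, 0 ≤ 1 / (e : ℝ) * y - l / e - k ∧ 1 / (e : ℝ) * y - l / e - k ≤ 1 / e := by
  have he0 : (0 : ℝ) < e := by exact_mod_cast he
  obtain ⟨k, hk⟩ := (Nat.modEq_iff_dvd.1 h.symm)
  have hk' : (⌊y⌋₊ : ℝ) = l + e * k := by
    have : ((⌊y⌋₊ : ℤ) : ℝ) - ((l : ℤ) : ℝ) = ((e : ℤ) : ℝ) * k := by exact_mod_cast hk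
    push_cast at this
    linarith
  have e1 : 1 / (e : ℝ) * y - l / e - k = (y - ⌊y⌋₊) / e := by
    rw [hk']
    field_simp
    ring
  refine ⟨k, ?_, ?_⟩ <;> rw [e1]
  · exact div_nonneg (by linarith [Nat.floor_le hy]) he0.le
  · gcongr
    linarith [Nat.lt_floor_add_one y]

/-- The mean of the exponential sums over the first `P` multiples of `n ↦ (M + n) ^ r / e`. -/
lemma exists_sum_norm_rpow_phase_le {r : ℝ} (hr : 1 < r) (hri : ∀ m : ℤ, r ≠ m) (q : ℕ)
    (hq : 2 ≤ q) :
    ∃ C : ℝ, 0 ≤ C ∧ ∀ M m e P : ℕ, 1 ≤ M → m ≤ M → 1 ≤ e → 1 ≤ P → P ≤ e →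
      (e : ℝ) ≤ (2 * M) ^ r →
      ∑ a ∈ Finset.range P,
        ‖∑ n ∈ Finset.range m, unitPhase (a * (1 / (e : ℝ) * ((M : ℝ) + n) ^ r))‖ ≤
      M + C * (M : ℝ) ^ (1 / (4 * (2 : ℝ) ^ q) ^ 2) *
        (P * M * ((e * (M : ℝ) ^ (q + 1 - r) / P) ^ (2 / (4 * (2 : ℝ) ^ q - 3)))⁻¹ +
          e * (M : ℝ) ^ (1 - r) * (M : ℝ) ^ (1 / (4 * (2 : ℝ) ^ q) ^ 2)) := by
  have hQ4 : (4 : ℝ) ≤ 2 ^ q := by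
    calc (4 : ℝ) = 2 ^ 2 := by norm_num
      _ ≤ 2 ^ q := pow_le_pow_right₀ (by norm_num) hq
  set Q : ℝ := 2 ^ q with hQ
  set ε : ℝ := 1 / (4 * Q) ^ 2 with hε
  have hε0 : 0 < ε := by positivity
  obtain ⟨b, α, hb, hα, hsize⟩ := exists_hasDiffSize_rpow (by linarith : 0 < r) hri (q + 2)
  obtain ⟨C, hC0, hC⟩ := expSumBound_iterate hα hε0 (by positivity : 0 < 1 / (2 * Q)) q
  obtain ⟨L, hL0, hL⟩ := exists_one_add_log_le_rpow (by positivity : 0 < ε / r) (2 ^ r)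
    (by positivity)
  set κ : ℝ := 2 / (4 * Q - 3) with hκ
  have hκ0 : 0 < κ := div_pos two_pos (by linarith)
  have hκe : 1 / (2 ^ q * (1 / (2 * Q) + 2) - 2) = κ := by
    rw [← hQ, hκ]
    have h1 : Q * (1 / (2 * Q) + 2) - 2 = (4 * Q - 3) / 2 := by
      field_simp
      ring
    rw [h1, one_div_div]
  rw [hκe] at hC
  refine ⟨C * (b ^ κ + L / b), by positivity, ?_⟩
  intro M m e P hM hm he hP hPe heM
  have hM0 : (0 : ℝ) < M := by exact_mod_cast hM
  have hM1 : (1 : ℝ) ≤ M := by exact_mod_cast hM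
  have he0 : (0 : ℝ) < e := by exact_mod_cast he
  have hP1 : (1 : ℝ) ≤ P := by exact_mod_cast hP
  have hP0 : (0 : ℝ) < P := by linarith
  have hPe' : (P : ℝ) ≤ e := by exact_mod_cast hPe
  have hm' : (m : ℝ) ≤ M := by exact_mod_cast hm
  set Z : ℝ := e * (M : ℝ) ^ (q + 1 - r) / P with hZ
  have hZ0 : 0 < Z := by positivity
  set F : ℝ := e * (M : ℝ) ^ (1 - r) with hF
  have hF0 : 0 < F := by positivity
  have hterm : ∀ i < P, ‖∑ n ∈ Finset.range m,
      unitPhase (((i + 1 : ℕ) : ℝ) * (1 / (e : ℝ) * ((M : ℝ) + n) ^ r))‖ ≤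
      C * (M : ℝ) ^ ε * (M * (b ^ κ * (Z ^ κ)⁻¹) + F / b * (1 / ((i : ℝ) + 1))) := by
    intro i hi
    have hi' : ((i : ℝ) + 1) ≤ P := by exact_mod_cast hi
    have h := hC M _ m _ hM1 (by positivity) hm'
      (hsize (((i + 1 : ℕ) : ℝ) / e) M m (by positivity) hM hm)
    have e1 : ∀ n : ℕ, ((i + 1 : ℕ) : ℝ) * (1 / (e : ℝ) * ((M : ℝ) + n) ^ r) =
        ((i + 1 : ℕ) : ℝ) / e * ((M : ℝ) + n) ^ r := fun n => by ring
    simp only [e1]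
    refine h.trans ?_
    have hMr : (M : ℝ) ^ (1 - r) * (M : ℝ) ^ (r - 1) = 1 := by
      rw [← Real.rpow_add hM0]
      simp
    have e2 : 1 / (b * (((i + 1 : ℕ) : ℝ) / e * (M : ℝ) ^ (r - 1))) =
        F / b * (1 / ((i : ℝ) + 1)) := by
      have : (0 : ℝ) < (M : ℝ) ^ (r - 1) := by positivity
      rw [div_eq_iff (by positivity), hF]
      push_cast
      field_simp
      linarith
    have e3 : (b * (((i + 1 : ℕ) : ℝ) / e * (M : ℝ) ^ (r - 1)) / (M : ℝ) ^ q) ^ κ ≤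
        b ^ κ * (Z ^ κ)⁻¹ := by
      rw [← Real.inv_rpow hZ0.le, ← Real.mul_rpow hb.le (by positivity)]
      refine Real.rpow_le_rpow (by positivity) ?_ hκ0.le
      have a1 : Z⁻¹ = P / e * (M : ℝ) ^ (r - 1) / (M : ℝ) ^ q := by
        have : (M : ℝ) ^ (q + 1 - r) * (M : ℝ) ^ (r - 1) = (M : ℝ) ^ q := by
          rw [← Real.rpow_add hM0, ← Real.rpow_natCast]
          ring_nf
        rw [hZ, ← this]
        field_simp
      rw [a1]
      push_cast
      have a2 : b * (((i : ℝ) + 1) / e * (M : ℝ) ^ (r - 1)) / (M : ℝ) ^ q =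
        b * (((i : ℝ) + 1) / e * (M : ℝ) ^ (r - 1) / (M : ℝ) ^ q) := by ring
      rw [a2]
      gcongr
    rw [e2]
    gcongr
  have hlog : ∑ i ∈ Finset.range P, 1 / ((i : ℝ) + 1) ≤ L * (M : ℝ) ^ ε := by
    refine (sum_range_one_div_le_one_add_log P).trans ?_
    have h := hL ((M : ℝ) ^ r) (Real.one_le_rpow hM1 (by linarith)) P hP1 (by
      rw [← Real.mul_rpow (by norm_num) hM0.le]
      exact hPe'.trans heM)
    rwa [← Real.rpow_mul hM0.le, mul_div_cancel₀ _ (by linarith)] at h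
  set f : ℕ → ℝ := fun a =>
    ‖∑ n ∈ Finset.range m, unitPhase (a * (1 / (e : ℝ) * ((M : ℝ) + n) ^ r))‖ with hf
  have h0 : ∑ a ∈ Finset.range P, f a ≤ ∑ a ∈ Finset.range (P + 1), f a := by
    rw [Finset.sum_range_succ]
    linarith [norm_nonneg (∑ n ∈ Finset.range m,
      unitPhase (P * (1 / (e : ℝ) * ((M : ℝ) + n) ^ r)))]
  rw [Finset.sum_range_succ'] at h0
  have h1 : f 0 ≤ M := (norm_sum_unitPhase_le_card _ m).trans hm'
  have h2 := Finset.sum_le_sum fun i hi => hterm i (Finset.mem_range.1 hi)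
  rw [← Finset.mul_sum, Finset.sum_add_distrib, Finset.sum_const, Finset.card_range,
    nsmul_eq_mul, ← Finset.mul_sum] at h2
  have h3 : C * (M : ℝ) ^ ε * (P * (M * (b ^ κ * (Z ^ κ)⁻¹)) +
      F / b * ∑ i ∈ Finset.range P, 1 / ((i : ℝ) + 1)) ≤
      C * (M : ℝ) ^ ε * ((b ^ κ + L / b) * (P * M * (Z ^ κ)⁻¹ + F * (M : ℝ) ^ ε)) := by
    have : F / b * ∑ i ∈ Finset.range P, 1 / ((i : ℝ) + 1) ≤ F / b * (L * (M : ℝ) ^ ε) := by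
      gcongr
    refine mul_le_mul_of_nonneg_left ?_ (by positivity)
    have a1 : 0 ≤ L / b * (P * M * (Z ^ κ)⁻¹) := by positivity
    have a2 : 0 ≤ b ^ κ * (F * (M : ℝ) ^ ε) := by positivity
    have a3 : F / b * (L * (M : ℝ) ^ ε) = L / b * (F * (M : ℝ) ^ ε) := by ring
    linarith
  calc _ ≤ _ := h0
    _ ≤ M + C * (M : ℝ) ^ ε * ((b ^ κ + L / b) * (P * M * (Z ^ κ)⁻¹ + F * (M : ℝ) ^ ε)) := by
      linarith
    _ = _ := by ring

/-- The count of a residue class of `⌊k ^ r⌋` on a dyadic block. -/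
lemma exists_card_block_le {r : ℝ} (hr : 1 < r) (hri : ∀ m : ℤ, r ≠ m) (q : ℕ)
    (hq : 2 ≤ q) (hrq : r ≤ q) :
    ∃ C : ℝ, 0 ≤ C ∧ ∀ M m e l : ℕ, 1 ≤ M → m ≤ M → 1 ≤ e → (e : ℝ) ≤ (2 * M) ^ r →
      (((Finset.range m).filter fun n => ⌊((M + n : ℕ) : ℝ) ^ r⌋₊ ≡ l [MOD e]).card : ℝ) ≤
      C * (M / e + M / ((M : ℝ) ^ (q + 2 - r) * e) ^ (1 / (4 * (2 : ℝ) ^ q - 1))) := by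
  obtain ⟨C, hC0, hC⟩ := exists_sum_norm_rpow_phase_le hr hri q hq
  have hQ4 : (4 : ℝ) ≤ 2 ^ q := by
    calc (4 : ℝ) = 2 ^ 2 := by norm_num
      _ ≤ 2 ^ q := pow_le_pow_right₀ (by norm_num) hq
  have hqQ : (q : ℝ) + 1 ≤ 2 ^ q := by exact_mod_cast q.lt_two_pow_self
  set D : ℝ := 4 * 2 ^ q with hD
  have hD16 : 16 ≤ D := by linarith
  set ε : ℝ := 1 / D ^ 2 with hε
  have hε0 : 0 < ε := by positivity
  have hε4 : ε ≤ 1 / 4 := by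
    rw [hε]
    gcongr
    nlinarith
  refine ⟨8 * (12 + C + 14 * C * 2 ^ r), by positivity, ?_⟩
  intro M m e l hM hm he heM
  have hM0 : (0 : ℝ) < M := by exact_mod_cast hM
  have hM1 : (1 : ℝ) ≤ M := by exact_mod_cast hM
  have he1 : (1 : ℝ) ≤ e := by exact_mod_cast he
  have he0 : (0 : ℝ) < e := by linarith
  have hm' : (m : ℝ) ≤ M := by exact_mod_cast hm
  set S := (Finset.range m).filter fun n => ⌊((M + n : ℕ) : ℝ) ^ r⌋₊ ≡ l [MOD e] with hS
  have hSm : (S.card : ℝ) ≤ M := by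
    refine le_trans ?_ hm'
    exact_mod_cast (Finset.card_filter_le _ _).trans_eq (Finset.card_range m)
  set T : ℝ := (M : ℝ) ^ (q + 2 - r) * e with hT
  have hT1 : 1 ≤ T :=
    one_le_mul_of_one_le_of_one_le (Real.one_le_rpow hM1 (by linarith)) he1
  have hT0 : 0 < T := by linarith
  set H : ℝ := T ^ (1 / (D - 1)) with hH
  have hH1 : 1 ≤ H := Real.one_le_rpow hT1 (by
    have : 0 < D - 1 := by linarith
    positivity)
  have hH0 : 0 < H := by linarith
  have hHD : H ^ (D - 1) = T := by
    rw [hH, ← Real.rpow_mul hT0.le, one_div_mul_cancel (by linarith), Real.rpow_one]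
  have h2r : (1 : ℝ) ≤ 2 ^ r := Real.one_le_rpow (by norm_num) (by linarith)
  have heM' : (e : ℝ) ≤ 2 ^ r * M ^ r := by
    rwa [Real.mul_rpow (by norm_num) hM0.le] at heM
  rcases lt_or_ge (e : ℝ) 6 with he6 | he6
  · refine hSm.trans ?_
    have h1 : (M : ℝ) ≤ 96 * (M / e) := by
      rw [mul_div_assoc', le_div_iff₀ he0]
      nlinarith
    have h2 : 0 ≤ M / H := by positivity
    have h3 : 0 ≤ M / (e : ℝ) := by positivity
    have h4 : 0 ≤ C + 14 * C * 2 ^ r := by positivity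
    nlinarith [mul_nonneg h4 h2, mul_nonneg h4 h3]
  set G : ℝ := M ^ (2 * ε) with hG
  have hG1 : 1 ≤ G := Real.one_le_rpow hM1 (by positivity)
  have hG0 : 0 < G := by linarith
  have hGG : (M : ℝ) ^ ε * (M : ℝ) ^ ε = G := by
    rw [← Real.rpow_add hM0, hG]
    ring_nf
  set X : ℝ := min (H * G) (e / 6) with hX
  have hX1 : 1 ≤ X := le_min (one_le_mul_of_one_le_of_one_le hH1 hG1) (by linarith)
  set P : ℕ := ⌊X⌋₊ with hP
  have hP1 : 1 ≤ P := Nat.le_floor (by simpa using hX1)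
  have hP1' : (1 : ℝ) ≤ P := by exact_mod_cast hP1
  have hP0 : (0 : ℝ) < P := by linarith
  have hPX : (P : ℝ) ≤ X := Nat.floor_le (by linarith)
  have hPH : (P : ℝ) ≤ H * G := hPX.trans (min_le_left _ _)
  have hPe : (P : ℝ) ≤ e / 6 := hPX.trans (min_le_right _ _)
  have hPe' : P ≤ e := by
    have : (P : ℝ) ≤ e := by linarith
    exact_mod_cast this
  have hPinv : 1 / (P : ℝ) ≤ 2 / (H * G) + 12 / e := by
    have h1 : X ≤ 2 * P := by linarith [Nat.lt_floor_add_one X]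
    have h2 : 1 / (P : ℝ) ≤ 2 / X := by
      rw [div_le_div_iff₀ hP0 (by linarith)]
      linarith
    refine h2.trans ?_
    rcases min_choice (H * G) (e / 6 : ℝ) with h | h
    · rw [hX, h]
      linarith [(by positivity : 0 ≤ 12 / (e : ℝ))]
    · rw [hX, h]
      have : 2 / ((e : ℝ) / 6) = 12 / e := by field_simp; norm_num
      linarith [(by positivity : 0 ≤ 2 / (H * G))]
  have hcard := card_le_sum_norm_sum_unitPhase
    (fun n => 1 / (e : ℝ) * ((M : ℝ) + n) ^ r) m P hP1 (l / e) S (Finset.filter_subset _ _) (by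
      intro n hn
      have h1 := (Finset.mem_filter.1 hn).2
      push_cast at h1
      obtain ⟨k, hk0, hk1⟩ := exists_int_floor_modEq he (by positivity) h1
      refine ⟨k, hk0, hk1.trans ?_⟩
      gcongr
      linarith)
  have hsum := hC M m e P hM hm he hP1 hPe' heM
  set Z : ℝ := e * (M : ℝ) ^ (q + 1 - r) / P with hZ
  have hZ0 : 0 < Z := by positivity
  set F : ℝ := e * (M : ℝ) ^ (1 - r) with hF
  have hbal : (M : ℝ) ^ ε * H ≤ Z ^ (2 / (D - 3)) := by
    refine rpow_mul_le_rpow_of_balance hD16 hM1 ?_ hH1 hPH ?_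
    · rw [hZ, le_div_iff₀ hP0]
      have : (M : ℝ) ≤ M ^ (q + 1 - r) := by
        nth_rewrite 1 [← Real.rpow_one (M : ℝ)]
        exact Real.rpow_le_rpow_of_exponent_le hM1 (by linarith)
      rw [mul_comm]
      gcongr
    · rw [hHD, hT, hZ, mul_div_cancel₀ _ hP0.ne',
        show (q : ℝ) + 2 - r = 1 + (q + 1 - r) by ring, Real.rpow_add hM0, Real.rpow_one]
      ring
  have hmain : (M : ℝ) ^ ε * (Z ^ (2 / (D - 3)))⁻¹ ≤ 1 / H := by
    rw [← div_eq_mul_inv, div_le_div_iff₀ (by positivity) hH0]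
    linarith
  have hFM : F ≤ 2 ^ r * M := by
    calc F ≤ 2 ^ r * M ^ r * M ^ (1 - r) := by rw [hF]; gcongr
      _ = _ := by rw [mul_assoc, ← Real.rpow_add hM0]; simp
  have hHM : H * ((M : ℝ) ^ (1 - r) * G) ≤ 2 ^ r * M := by
    have h1 : H ≤ 2 ^ r * M ^ (1 / 2 : ℝ) := by
      have h2 : T ≤ (2 ^ r * M ^ (1 / 2 : ℝ)) ^ (D - 1) := by
        rw [Real.mul_rpow (by positivity) (by positivity), ← Real.rpow_mul hM0.le]
        calc T ≤ M ^ (q + 2 - r) * (2 ^ r * M ^ r) := by rw [hT]; gcongr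
          _ = 2 ^ r * M ^ ((q : ℝ) + 2) := by
            rw [mul_left_comm, ← Real.rpow_add hM0]
            ring_nf
          _ ≤ _ := by
            refine mul_le_mul ?_ ?_ (by positivity) (by positivity)
            · exact Real.self_le_rpow_of_one_le h2r (by linarith)
            · exact Real.rpow_le_rpow_of_exponent_le hM1 (by linarith)
      rw [← hHD] at h2
      exact (Real.rpow_le_rpow_iff hH0.le (by positivity) (by linarith)).1 h2
    have h3 : (M : ℝ) ^ (1 - r) ≤ 1 := Real.rpow_le_one_of_one_le_of_nonpos hM1 (by linarith)
    have h4 : G ≤ M ^ (1 / 2 : ℝ) := Real.rpow_le_rpow_of_exponent_le hM1 (by linarith)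
    calc _ ≤ 2 ^ r * (M : ℝ) ^ (1 / 2 : ℝ) * (1 * (M : ℝ) ^ (1 / 2 : ℝ)) := by gcongr
      _ = 2 ^ r * ((M : ℝ) ^ (1 / 2 : ℝ) * (M : ℝ) ^ (1 / 2 : ℝ)) := by ring
      _ = _ := by rw [← Real.rpow_add hM0]; norm_num
  have hA : M * (1 / (P : ℝ)) ≤ 2 * (M / H) + 12 * (M / e) := by
    calc M * (1 / (P : ℝ)) ≤ M * (2 / (H * G) + 12 / e) := by gcongr
      _ ≤ M * (2 / (H * 1) + 12 / e) := by gcongr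
      _ = _ := by ring
  have hB : F * G * (1 / (P : ℝ)) ≤ 14 * 2 ^ r * (M / H) := by
    have h1 : (M : ℝ) ^ (1 - r) * G ≤ 2 ^ r * M / H := by
      rw [le_div_iff₀ hH0]
      linarith
    have hF0 : 0 < F := by positivity
    calc F * G * (1 / (P : ℝ)) ≤ F * G * (2 / (H * G) + 12 / e) := by gcongr
      _ = 2 * F / H + 12 * ((M : ℝ) ^ (1 - r) * G) := by
        rw [hF]
        field_simp
      _ ≤ 2 * (2 ^ r * M) / H + 12 * (2 ^ r * M / H) := by gcongr
      _ = _ := by ring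
  have hfin : (S.card : ℝ) ≤ 8 * (M * (1 / (P : ℝ)) +
      C * (M * ((M : ℝ) ^ ε * (Z ^ (2 / (D - 3)))⁻¹) + F * G * (1 / (P : ℝ)))) := by
    refine hcard.trans ((mul_le_mul_of_nonneg_left hsum (by positivity)).trans_eq ?_)
    rw [← hGG]
    field_simp
  refine hfin.trans ?_
  have h1 : (M : ℝ) * ((M : ℝ) ^ ε * (Z ^ (2 / (D - 3)))⁻¹) ≤ M / H :=
    (mul_le_mul_of_nonneg_left hmain hM0.le).trans_eq (by ring)
  have h2 : C * (M * ((M : ℝ) ^ ε * (Z ^ (2 / (D - 3)))⁻¹) + F * G * (1 / (P : ℝ))) ≤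
      C * (M / H + 14 * 2 ^ r * (M / H)) := by gcongr
  have h3 : 0 ≤ M / H := by positivity
  have h4 : 0 ≤ (C + 14 * C * 2 ^ r) * (M / (e : ℝ)) := by positivity
  linarith

/-- The count of a residue class of `⌊k ^ r⌋` for `0 < k ≤ N`. -/
lemma exists_card_Ioc_le {r : ℝ} (hr : 1 < r) (hri : ∀ m : ℤ, r ≠ m) (q : ℕ)
    (hq : 2 ≤ q) (hrq : r ≤ q) {β γ : ℝ} (hγ : γ = 1 / (4 * (2 : ℝ) ^ q - 1))
    (hβ : β = 1 - (q + 2 - r) * γ) :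
    ∃ C : ℝ, 0 ≤ C ∧ ∀ e l : ℕ, 1 ≤ e → ∀ N : ℕ,
      (((Finset.Ioc 0 N).filter fun k : ℕ => ⌊(k : ℝ) ^ r⌋₊ ≡ l [MOD e]).card : ℝ) ≤
      C * (N / e + (N : ℝ) ^ β * (e : ℝ) ^ (-γ)) + (e : ℝ) ^ (1 / r) := by
  obtain ⟨C, hC0, hC⟩ := exists_card_block_le hr hri q hq hrq
  have hqQ : (q : ℝ) + 1 ≤ 2 ^ q := by exact_mod_cast q.lt_two_pow_self
  have hq0 : (0 : ℝ) ≤ q := q.cast_nonneg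
  have hγ0 : 0 < γ := by
    rw [hγ]
    exact one_div_pos.2 (by linarith)
  have hβ0 : 0 < β := by
    have : (q + 2 - r) * γ < 1 := by
      rw [hγ, mul_one_div, div_lt_one (by linarith)]
      linarith
    linarith
  have hβ1 : β ≤ 1 := by
    have : 0 ≤ (q + 2 - r) * γ := mul_nonneg (by linarith) hγ0.le
    linarith
  set δ : ℝ := (1 / 2) ^ β with hδ
  have hδ1 : δ < 1 := Real.rpow_lt_one (by norm_num) (by norm_num) hβ0
  have hδ2 : 1 / 2 ≤ δ := by
    simpa [hδ] using Real.rpow_le_rpow_of_exponent_ge (by norm_num) (by norm_num : (1 / 2 : ℝ) ≤ 1) hβ1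
  have hδ' : 0 < 1 - δ := by linarith
  refine ⟨C / (1 - δ), by positivity, fun e l he N => ?_⟩
  have he1 : (1 : ℝ) ≤ e := by exact_mod_cast he
  have he0 : (0 : ℝ) < e := by linarith
  induction N using Nat.strong_induction_on with
  | _ N ih =>
  rcases le_or_gt (N : ℝ) ((e : ℝ) ^ (1 / r)) with hN | hN
  · refine le_trans ?_ (hN.trans (le_add_of_nonneg_left (by positivity)))
    exact_mod_cast (Finset.card_filter_le _ _).trans_eq (by simp)
  have hN0 : (0 : ℝ) < N := lt_of_le_of_lt (by positivity) hN
  have hN1 : 0 < N := by exact_mod_cast hN0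
  have heN : (e : ℝ) ≤ (N : ℝ) ^ r := by
    calc (e : ℝ) = ((e : ℝ) ^ (1 / r)) ^ r := by
          rw [← Real.rpow_mul he0.le, one_div_mul_cancel (by linarith), Real.rpow_one]
      _ ≤ _ := Real.rpow_le_rpow (by positivity) hN.le (by linarith)
  have hIH := ih (N / 2) (by omega)
  set M : ℕ := N / 2 + 1 with hM
  have hMN : (M : ℝ) ≤ N := by exact_mod_cast (by omega : M ≤ N)
  have hM0 : (0 : ℝ) < M := by positivity
  have hblock := hC M (N - N / 2) e l (by omega) (by omega) he (heN.trans (by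
    refine Real.rpow_le_rpow hN0.le ?_ (by linarith)
    exact_mod_cast (by omega : N ≤ 2 * M)))
  have hsplit : ((Finset.Ioc 0 N).filter fun k : ℕ => ⌊(k : ℝ) ^ r⌋₊ ≡ l [MOD e]) ⊆
      ((Finset.Ioc 0 (N / 2)).filter fun k : ℕ => ⌊(k : ℝ) ^ r⌋₊ ≡ l [MOD e]) ∪
      ((Finset.range (N - N / 2)).filter
        fun n => ⌊((M + n : ℕ) : ℝ) ^ r⌋₊ ≡ l [MOD e]).image fun n => M + n := by
    intro k hk
    simp only [Finset.mem_filter, Finset.mem_Ioc, Finset.mem_union, Finset.mem_image,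
      Finset.mem_range] at hk ⊢
    rcases le_or_gt k (N / 2) with h | h
    · exact Or.inl ⟨⟨hk.1.1, h⟩, hk.2⟩
    · have hkM : M + (k - M) = k := by omega
      exact Or.inr ⟨k - M, ⟨by omega, by rw [hkM]; exact hk.2⟩, hkM⟩
  have hcard : (((Finset.Ioc 0 N).filter fun k : ℕ => ⌊(k : ℝ) ^ r⌋₊ ≡ l [MOD e]).card : ℝ) ≤
      (((Finset.Ioc 0 (N / 2)).filter fun k : ℕ => ⌊(k : ℝ) ^ r⌋₊ ≡ l [MOD e]).card : ℝ) +
      (((Finset.range (N - N / 2)).filter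
        fun n => ⌊((M + n : ℕ) : ℝ) ^ r⌋₊ ≡ l [MOD e]).card : ℝ) := by
    exact_mod_cast (Finset.card_le_card hsplit).trans ((Finset.card_union_le _ _).trans
      (Nat.add_le_add_left Finset.card_image_le _))
  have hpow : (M : ℝ) / ((M : ℝ) ^ (q + 2 - r) * e) ^ (1 / (4 * (2 : ℝ) ^ q - 1)) ≤
      (N : ℝ) ^ β * (e : ℝ) ^ (-γ) := by
    calc _ = (M : ℝ) ^ β * (e : ℝ) ^ (-γ) := by
          rw [← hγ, Real.mul_rpow (by positivity) he0.le, ← Real.rpow_mul hM0.le, hβ,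
            Real.rpow_sub hM0, Real.rpow_one, Real.rpow_neg he0.le]
          field_simp
      _ ≤ _ := by gcongr
  have hhalf : ((N / 2 : ℕ) : ℝ) ≤ 1 / 2 * N := by
    have := @Nat.cast_div_le ℝ _ _ _ N 2
    push_cast at this
    linarith
  have hhalf' : ((N / 2 : ℕ) : ℝ) ^ β ≤ δ * (N : ℝ) ^ β := by
    rw [hδ, ← Real.mul_rpow (by norm_num) hN0.le]
    exact Real.rpow_le_rpow (by positivity) hhalf hβ0.le
  have hhalf'' : ((N / 2 : ℕ) : ℝ) ≤ δ * N := hhalf.trans (by gcongr)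
  set A : ℝ := N / e + (N : ℝ) ^ β * (e : ℝ) ^ (-γ) with hA
  have h1 : ((N / 2 : ℕ) : ℝ) / e + ((N / 2 : ℕ) : ℝ) ^ β * (e : ℝ) ^ (-γ) ≤ δ * A := by
    calc _ ≤ δ * N / e + δ * (N : ℝ) ^ β * (e : ℝ) ^ (-γ) := by gcongr
      _ = _ := by rw [hA]; ring
  have h2 : (M : ℝ) / e + M / ((M : ℝ) ^ (q + 2 - r) * e) ^ (1 / (4 * (2 : ℝ) ^ q - 1)) ≤ A := by
    rw [hA]
    gcongr
  calc _ ≤ _ := hcard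
    _ ≤ (C / (1 - δ) * (δ * A) + (e : ℝ) ^ (1 / r)) + C * A := by
      refine add_le_add (hIH.trans ?_) (hblock.trans ?_) <;> gcongr
    _ = _ := by
      field_simp
      ring

/-- with `q = ⌊r⌋ + 1`, `Q = 2^q`, `κ = 1/(4Q − 2)`,
`λ = 1 − (q+1)/(4Q − 2)`, the number of positive `k ≤ (log(2x)/log 2)^{1/r}` with
`⌊k^r⌋ ≡ ℓ (mod e)` is
`≪_r (log x)^{1/r}/e + (log x)^{(1/r)·(rκ+λ)/(1+κ)} · e^{−κ/(1+κ)} + e^{1/r}`. -/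
theorem count_congruence_exponent_pair (r : ℝ) (hr : 1 < r) (hri : ∀ m : ℤ, r ≠ m)
    (q Q : ℕ) (hq : q = ⌊r⌋₊ + 1) (hQ : Q = 2 ^ q)
    (κ lam : ℝ) (hκ : κ = 1 / (4 * (Q : ℝ) - 2))
    (hlamdef : lam = 1 - ((q : ℝ) + 1) / (4 * (Q : ℝ) - 2)) :
    ∃ C x₀ : ℝ, ∀ x : ℝ, x₀ ≤ x → ∀ e : ℕ, 1 ≤ e → ∀ l : ℕ, l ≤ e - 1 →
      (({k : ℕ | 0 < k ∧ (k : ℝ) ≤ (Real.log (2 * x) / Real.log 2) ^ (1 / r) ∧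
        ⌊(k : ℝ) ^ r⌋₊ ≡ l [MOD e]} : Set ℕ).ncard : ℝ) ≤
      C * ((Real.log x) ^ (1 / r) / (e : ℝ)
        + (Real.log x) ^ ((1 / r) * (r * κ + lam) / (1 + κ)) * (e : ℝ) ^ (-(κ / (1 + κ)))
        + (e : ℝ) ^ (1 / r)) := by
  have hr0 : 0 < r := by linarith
  have hq2 : 2 ≤ q := by
    have : 1 ≤ ⌊r⌋₊ := Nat.le_floor (by simpa using hr.le)
    omega
  have hrq : r ≤ q := by
    rw [hq]
    push_cast
    exact (Nat.lt_floor_add_one r).le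
  have hQ' : (Q : ℝ) = 2 ^ q := by rw [hQ]; push_cast; rfl
  have hqQ : (q : ℝ) + 1 ≤ Q := by
    rw [hQ]
    exact_mod_cast q.lt_two_pow_self
  have hq0 : (0 : ℝ) ≤ q := q.cast_nonneg
  have hD : 4 * (Q : ℝ) - 2 ≠ 0 := by linarith
  have hD' : 4 * (Q : ℝ) - 1 ≠ 0 := by linarith
  have h1κ : 1 + κ = (4 * Q - 1) / (4 * Q - 2) := by
    rw [hκ]
    field_simp
    ring
  set γ : ℝ := κ / (1 + κ) with hγ
  set β : ℝ := (r * κ + lam) / (1 + κ) with hβ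
  have hγ' : γ = 1 / (4 * (2 : ℝ) ^ q - 1) := by
    rw [hγ, h1κ, hκ, ← hQ']
    field_simp
  have hβ' : β = 1 - (q + 2 - r) * γ := by
    rw [hβ, hγ, h1κ, hlamdef, hκ]
    field_simp
    ring
  have hβ0 : 0 ≤ β := by
    have : (q + 2 - r) * γ ≤ 1 := by
      rw [hγ', ← hQ', mul_one_div, div_le_one (by linarith)]
      linarith
    linarith
  obtain ⟨C, hC0, hC⟩ := exists_card_Ioc_le hr hri q hq2 hrq hγ' hβ'
  have hlog2 : 0 < Real.log 2 := Real.log_pos (by norm_num)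
  set B : ℝ := (2 / Real.log 2) ^ (1 / r) with hB
  have hB0 : 0 < B := by positivity
  refine ⟨C * (B + B ^ β) + 1, 2, fun x hx e he l _ => ?_⟩
  have he0 : (0 : ℝ) < e := by exact_mod_cast he
  have hL : 0 < Real.log x := Real.log_pos (by linarith)
  set Y : ℝ := Real.log x ^ (1 / r) with hY
  have hY0 : 0 < Y := by positivity
  set X : ℝ := (Real.log (2 * x) / Real.log 2) ^ (1 / r) with hX
  have hXY : X ≤ B * Y := by
    rw [hX, hB, hY, ← Real.mul_rpow (by positivity) hL.le]
    refine Real.rpow_le_rpow (div_nonneg (Real.log_nonneg (by linarith)) hlog2.le) ?_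
      (by positivity)
    rw [div_mul_eq_mul_div]
    gcongr
    rw [Real.log_mul (by norm_num) (by linarith)]
    linarith [Real.log_le_log (by norm_num) hx]
  have hX0 : 0 ≤ X :=
    Real.rpow_nonneg (div_nonneg (Real.log_nonneg (by linarith)) hlog2.le) _
  have hN : (⌊X⌋₊ : ℝ) ≤ B * Y := (Nat.floor_le hX0).trans hXY
  have hexp : Real.log x ^ ((1 / r) * (r * κ + lam) / (1 + κ)) = Y ^ β := by
    rw [hY, ← Real.rpow_mul hL.le, hβ, mul_div_assoc]
  rw [hexp]
  have hset : {k : ℕ | 0 < k ∧ (k : ℝ) ≤ X ∧ ⌊(k : ℝ) ^ r⌋₊ ≡ l [MOD e]} =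
      ((Finset.Ioc 0 ⌊X⌋₊).filter fun k : ℕ => ⌊(k : ℝ) ^ r⌋₊ ≡ l [MOD e] : Finset ℕ) := by
    ext k
    simp [Nat.le_floor_iff hX0, and_assoc]
  rw [hset, Set.ncard_coe_finset]
  have h1 : (⌊X⌋₊ : ℝ) / e ≤ B * (Y / e) := by
    rw [← mul_div_assoc]
    gcongr
  have h2 : (⌊X⌋₊ : ℝ) ^ β * (e : ℝ) ^ (-γ) ≤ B ^ β * (Y ^ β * (e : ℝ) ^ (-γ)) := by
    rw [← mul_assoc, ← Real.mul_rpow hB0.le hY0.le]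
    gcongr
  have hu : 0 ≤ Y / e := by positivity
  have hv : 0 ≤ Y ^ β * (e : ℝ) ^ (-γ) := by positivity
  have hw : 0 ≤ (e : ℝ) ^ (1 / r) := by positivity
  have hBβ : 0 ≤ B ^ β := by positivity
  calc _ ≤ C * (B * (Y / e) + B ^ β * (Y ^ β * (e : ℝ) ^ (-γ))) + (e : ℝ) ^ (1 / r) := by
        refine (hC e l he ⌊X⌋₊).trans ?_
        gcongr
    _ ≤ C * ((B + B ^ β) * (Y / e) + (B + B ^ β) * (Y ^ β * (e : ℝ) ^ (-γ))) +
        (e : ℝ) ^ (1 / r) := by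
      gcongr <;> linarith
    _ ≤ _ := by
      have : 0 ≤ C * (B + B ^ β) := by positivity
      nlinarith [mul_nonneg this hw]
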